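/- Let (W,S) be a Coxeter system of rank 3 with S = {r,s,t}, in which rt = tr (the product rt has order 2) and the orders m_{sr} of sr and m_{st} of st both satisfy m_{sr} ≥ 4 and m_{st} ≥ 4 (possibly infinite). Let {α, β} = {t, r}. Let x, y ∈ W and let w belong to the parabolic subgroup of W generated by {s, α}, with ℓ(w) ≥ 4 and with s, α ∉ R(x) ∪ L(y). Then (a) ℓ(xwy) = ℓ(x) + ℓ(w) + ℓ(y); (b) R(xwy) = R(wy); (c) L(xwy) = L(xw). -/

import Mathlib

open LaurentPolynomial

namespace CoxeterSystem

section General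

variable {B W : Type*} [Group W] {M : CoxeterMatrix B} (cs : CoxeterSystem M W)

open scoped Classical in
/-- The involution of `W × ZMod 2` attached to the simple reflection of index `i`: it conjugates the
first coordinate and flips the second one exactly when the first one is that simple reflection. -/
noncomputable def signedConj (i : B) : Equiv.Perm (W × ZMod 2) :=
  Function.Involutive.toPerm
    (fun p ↦ (cs.simple i * p.1 * cs.simple i, p.2 + if p.1 = cs.simple i then 1 else 0)) <| by
    rintro ⟨t, ε⟩
    have h : cs.simple i * t * cs.simple i = cs.simple i ↔ t = cs.simple i := by
      constructor
      · intro h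
        have := congrArg (fun g ↦ cs.simple i * g * cs.simple i) h
        simpa [mul_assoc] using this
      · rintro rfl; simp
    simp only [h, Prod.mk.injEq, add_assoc, CharTwo.add_self_eq_zero, add_zero, and_true]
    simp [mul_assoc]

open scoped Classical in
theorem signedConj_apply (i : B) (t : W) (ε : ZMod 2) :
    cs.signedConj i (t, ε) =
      (cs.simple i * t * cs.simple i, ε + if t = cs.simple i then 1 else 0) := rfl

open scoped Classical in
theorem signedConj_mul_pow_apply (i j : B) (k : ℕ) (t : W) (ε : ZMod 2) :
    ((cs.signedConj i * cs.signedConj j) ^ k) (t, ε) =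
      ((cs.simple i * cs.simple j) ^ k * t * ((cs.simple i * cs.simple j) ^ k)⁻¹,
        ε + ∑ n ∈ Finset.range (2 * k),
          if t = cs.simple j * (cs.simple i * cs.simple j) ^ n then 1 else 0) := by
  induction k with
  | zero => simp
  | succ k ih =>
    rw [pow_succ', Equiv.Perm.mul_apply, ih, Equiv.Perm.mul_apply, signedConj_apply,
      signedConj_apply, show 2 * (k + 1) = 2 * k + 1 + 1 by ring, Finset.sum_range_succ,
      Finset.sum_range_succ]
    set g := cs.simple i * cs.simple j with hg
    have hgj : cs.simple j * g = g⁻¹ * cs.simple j := by simp [hg, mul_assoc]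
    have hpow : ∀ n : ℕ, cs.simple j * g ^ n = (g ^ n)⁻¹ * cs.simple j := by
      intro n
      induction n with
      | zero => simp
      | succ n ih => rw [pow_succ, ← mul_assoc, ih, mul_assoc, hgj]; group
    have h₁ : g ^ k * t * (g ^ k)⁻¹ = cs.simple j ↔ t = cs.simple j * g ^ (2 * k) := by
      rw [two_mul, pow_add, ← mul_assoc, hpow, mul_inv_eq_iff_eq_mul, ← eq_inv_mul_iff_mul_eq,
        mul_assoc]
    have h₂ : cs.simple j * (g ^ k * t * (g ^ k)⁻¹) * cs.simple j = cs.simple i ↔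
        t = cs.simple j * g ^ (2 * k + 1) := by
      have e : cs.simple j * g ^ (2 * k + 1) =
          (g ^ k)⁻¹ * (cs.simple j * cs.simple i * cs.simple j) * g ^ k := by
        rw [show 2 * k + 1 = k + (1 + k) by ring, pow_add, pow_add, ← mul_assoc, hpow, pow_one, hg]
        simp only [mul_assoc]
      rw [e]
      constructor
      · intro h
        rw [← h]; simp [mul_assoc]
      · intro h
        rw [h]; simp [mul_assoc]
    simp only [h₁, h₂]
    ext
    · simp [hg, pow_succ', mul_assoc]
    · simp [add_assoc]

theorem isLiftable_signedConj : M.IsLiftable cs.signedConj := by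
  classical
  intro i j
  ext1 ⟨t, ε⟩
  have h : ∀ n, (cs.simple i * cs.simple j) ^ (M i j + n) = (cs.simple i * cs.simple j) ^ n := by
    intro n; rw [pow_add]; simp
  rw [signedConj_mul_pow_apply, two_mul, Finset.sum_range_add]
  simp [h, CharTwo.add_self_eq_zero]

open scoped Classical in
theorem lift_signedConj_wordProd (ω : List B) (t : W) :
    cs.lift ⟨cs.signedConj, cs.isLiftable_signedConj⟩ (cs.wordProd ω) (t, 0) =
      (cs.wordProd ω * t * (cs.wordProd ω)⁻¹, ((cs.rightInvSeq ω).count t : ZMod 2)) := by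
  induction ω with
  | nil => simp
  | cons i ω ih =>
    rw [wordProd_cons, map_mul, Equiv.Perm.mul_apply, ih, lift_apply_simple, signedConj_apply,
      rightInvSeq, List.count_cons]
    have h : cs.wordProd ω * t * (cs.wordProd ω)⁻¹ = cs.simple i ↔
        (cs.wordProd ω)⁻¹ * cs.simple i * cs.wordProd ω = t := by
      constructor
      · intro h; rw [← h]; group
      · intro h; rw [← h]; group
    ext
    · simp [mul_assoc]
    · simp [h]

/-- The exchange property, for a word that need not be reduced. -/
theorem exists_wordProd_eraseIdx_of_isRightDescent {ω : List B} {i : B}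
    (h : cs.IsRightDescent (cs.wordProd ω) i) :
    ∃ j < ω.length, cs.wordProd ω * cs.simple i = cs.wordProd (ω.eraseIdx j) := by
  classical
  obtain ⟨ω', hω', hprod⟩ := cs.exists_isReduced (cs.wordProd ω * cs.simple i)
  have hconcat : cs.wordProd (ω'.concat i) = cs.wordProd ω := by
    rw [wordProd_concat, ← hprod]; simp
  have hred : cs.IsReduced (ω'.concat i) := by
    have := cs.isRightDescent_iff.mp h
    rw [hprod, hω'.eq] at this
    rw [IsReduced, hconcat, ← this]; simp
  have hmem : cs.simple i ∈ cs.rightInvSeq (ω'.concat i) := by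
    rw [rightInvSeq_concat]; simp
  have hcount := congrArg Prod.snd (cs.lift_signedConj_wordProd (ω'.concat i) (cs.simple i))
  rw [hconcat, lift_signedConj_wordProd,
    List.count_eq_one_of_mem hred.nodup_rightInvSeq hmem] at hcount
  have hmem' : cs.simple i ∈ cs.rightInvSeq ω := by
    by_contra hn
    rw [List.count_eq_zero_of_not_mem hn] at hcount
    simp at hcount
  obtain ⟨j, hj, hji⟩ := List.mem_iff_getElem.mp hmem'
  refine ⟨j, by simpa using hj, ?_⟩
  rw [← wordProd_mul_getD_rightInvSeq, List.getD_eq_getElem _ _ hj, hji]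

/-- Every element of a standard parabolic subgroup has a reduced word with letters in it. -/
theorem exists_isReduced_of_mem_closure {J : Set B} {p : W}
    (hp : p ∈ Subgroup.closure (cs.simple '' J)) :
    ∃ ω : List B, (∀ i ∈ ω, i ∈ J) ∧ cs.IsReduced ω ∧ p = cs.wordProd ω := by
  have step : ∀ (p : W) (i : B), i ∈ J →
      (∃ ω : List B, (∀ i ∈ ω, i ∈ J) ∧ cs.IsReduced ω ∧ p = cs.wordProd ω) →
      ∃ ω : List B, (∀ i ∈ ω, i ∈ J) ∧ cs.IsReduced ω ∧ p * cs.simple i = cs.wordProd ω := by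
    rintro p i hi ⟨ω, hJ, hred, rfl⟩
    by_cases hd : cs.IsRightDescent (cs.wordProd ω) i
    · obtain ⟨j, hj, hprod⟩ := cs.exists_wordProd_eraseIdx_of_isRightDescent hd
      refine ⟨ω.eraseIdx j, fun k hk ↦ hJ k (List.mem_of_mem_eraseIdx hk), ?_, hprod⟩
      have := cs.isRightDescent_iff.mp hd
      rw [hprod, hred.eq] at this
      rw [IsReduced, List.length_eraseIdx_of_lt hj]
      lia
    · refine ⟨ω.concat i, ?_, ?_, by rw [wordProd_concat]⟩
      · intro k hk
        rw [List.concat_eq_append, List.mem_append, List.mem_singleton] at hk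
        rcases hk with hk | rfl
        exacts [hJ k hk, hi]
      · rw [IsReduced, wordProd_concat, cs.not_isRightDescent_iff.mp hd, hred.eq]; simp
  induction hp using Subgroup.closure_induction_right with
  | one => exact ⟨[], by simp, by simp [IsReduced], by simp⟩
  | mul_right p _ q hq ih =>
    obtain ⟨i, hi, rfl⟩ := hq
    exact step p i hi ih
  | mul_inv_cancel p _ q hq ih =>
    obtain ⟨i, hi, rfl⟩ := hq
    rw [inv_simple]
    exact step p i hi ih

theorem wordProd_mem_closure {J : Set B} {ω : List B} (h : ∀ i ∈ ω, i ∈ J) :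
    cs.wordProd ω ∈ Subgroup.closure (cs.simple '' J) := by
  induction ω with
  | nil => simp
  | cons i ω ih =>
    rw [wordProd_cons]
    exact mul_mem (Subgroup.subset_closure ⟨i, h i (by simp), rfl⟩)
      (ih fun k hk ↦ h k (by simp [hk]))

theorem simple_mem_closure {J : Set B} {i : B} (h : i ∈ J) :
    cs.simple i ∈ Subgroup.closure (cs.simple '' J) :=
  Subgroup.subset_closure ⟨i, h, rfl⟩

/-- A nontrivial element of a standard parabolic subgroup has a right descent in it. -/
theorem exists_isRightDescent_of_mem_closure {J : Set B} {p : W}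
    (hp : p ∈ Subgroup.closure (cs.simple '' J)) (h1 : p ≠ 1) :
    ∃ j ∈ J, cs.IsRightDescent p j := by
  obtain ⟨ω, hJ, hred, rfl⟩ := cs.exists_isReduced_of_mem_closure hp
  rcases List.eq_nil_or_concat ω with rfl | ⟨ω', i, rfl⟩
  · simp at h1
  · refine ⟨i, hJ i (by simp), ?_⟩
    have := hred.eq
    rw [IsRightDescent, this, wordProd_concat]
    have := cs.length_wordProd_le ω'
    simp
    lia

/-- Every element factors, with additive lengths, through a standard parabolic subgroup. -/
theorem exists_mul_mem_closure (J : Set B) (g : W) :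
    ∃ z p : W, p ∈ Subgroup.closure (cs.simple '' J) ∧ (∀ j ∈ J, ¬cs.IsRightDescent z j) ∧
      g = z * p ∧ cs.length g = cs.length z + cs.length p := by
  induction hn : cs.length g using Nat.strong_induction_on generalizing g with
  | _ n ih =>
    by_cases hg : ∀ j ∈ J, ¬cs.IsRightDescent g j
    · exact ⟨g, 1, one_mem _, hg, by simp, by simp [hn]⟩
    · push Not at hg
      obtain ⟨j, hj, hd⟩ := hg
      have hlen := cs.isRightDescent_iff.mp hd
      obtain ⟨z, p, hp, hz, he, hl⟩ := ih _ (by lia) (g * cs.simple j) rfl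
      have he' : g = z * (p * cs.simple j) := by
        rw [← mul_assoc, ← he]; simp
      refine ⟨z, p * cs.simple j, mul_mem hp (cs.simple_mem_closure hj), hz, he', ?_⟩
      have h1 := cs.length_mul_le p (cs.simple j)
      have h2 := cs.length_mul_le z (p * cs.simple j)
      rw [← he'] at h2
      rw [cs.length_simple] at h1
      lia

theorem length_mul_of_forall_length_le {J : Set B} {z p : W}
    (hz : ∀ q ∈ Subgroup.closure (cs.simple '' J), cs.length z ≤ cs.length (z * q))
    (hp : p ∈ Subgroup.closure (cs.simple '' J)) :
    cs.length (z * p) = cs.length z + cs.length p := by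
  obtain ⟨ω, hJ, hred, rfl⟩ := cs.exists_isReduced_of_mem_closure hp
  clear hp
  induction ω using List.reverseRecOn with
  | nil => simp
  | append_singleton ω i ih =>
    have hred' : cs.IsReduced ω := by simpa using hred.take ω.length
    have hJ' : ∀ k ∈ ω, k ∈ J := fun k hk ↦ hJ k (by simp [hk])
    have ihω := ih hJ' hred'
    rw [hred.eq, wordProd_append, wordProd_singleton, ← mul_assoc]
    rw [hred'.eq] at ihω
    by_cases hd : cs.IsRightDescent (z * cs.wordProd ω) i
    · exfalso
      obtain ⟨ζ, hζ, rfl⟩ := cs.exists_isReduced z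
      rw [← wordProd_append] at hd
      obtain ⟨j, hj, hprod⟩ := cs.exists_wordProd_eraseIdx_of_isRightDescent hd
      rcases lt_or_ge j ζ.length with hjζ | hjζ
      · rw [List.eraseIdx_append_of_lt_length hjζ, wordProd_append, wordProd_append,
          mul_assoc] at hprod
        have hq : cs.wordProd ω * cs.simple i * (cs.wordProd ω)⁻¹ ∈
            Subgroup.closure (cs.simple '' J) :=
          mul_mem (mul_mem (cs.wordProd_mem_closure hJ') (cs.simple_mem_closure (hJ i (by simp))))
            (inv_mem (cs.wordProd_mem_closure hJ'))
        have := hz _ hq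
        rw [← mul_assoc, hprod, mul_inv_cancel_right, hζ.eq] at this
        have h2 := cs.length_wordProd_le (ζ.eraseIdx j)
        rw [List.length_eraseIdx_of_lt hjζ] at h2
        lia
      · rw [List.eraseIdx_append_of_length_le hjζ, wordProd_append, wordProd_append, mul_assoc,
          mul_right_inj] at hprod
        have h1 := hred.eq
        rw [wordProd_append, wordProd_singleton, hprod] at h1
        have h2 := cs.length_wordProd_le (ω.eraseIdx (j - ζ.length))
        have h3 := List.length_eraseIdx_le ω (j - ζ.length)
        simp at h1
        lia
    · rw [cs.not_isRightDescent_iff.mp hd, ihω]; simp; lia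

/-- An element without right descents in `J` is the shortest one of its left coset. -/
theorem length_mul_of_forall_not_isRightDescent {J : Set B} {z p : W}
    (hz : ∀ j ∈ J, ¬cs.IsRightDescent z j) (hp : p ∈ Subgroup.closure (cs.simple '' J)) :
    cs.length (z * p) = cs.length z + cs.length p := by
  let P := Subgroup.closure (cs.simple '' J)
  obtain ⟨q, hq, hmin⟩ : ∃ q ∈ P, ∀ q' ∈ P, cs.length (z * q) ≤ cs.length (z * q') := by
    obtain ⟨q, hq⟩ := exists_minimal_of_wellFoundedLT (fun n ↦ ∃ q ∈ P, cs.length (z * q) = n)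
      ⟨_, 1, one_mem _, rfl⟩
    obtain ⟨q, hqP, rfl⟩ := hq.1
    refine ⟨q, hqP, fun q' hq' ↦ ?_⟩
    by_contra! hlt
    exact absurd (hq.2 ⟨q', hq', rfl⟩ hlt.le) (by lia)
  have hadd : ∀ g ∈ P, cs.length (z * q * g) = cs.length (z * q) + cs.length g := fun g hg ↦
    cs.length_mul_of_forall_length_le
      (fun g' hg' ↦ by rw [mul_assoc]; exact hmin _ (mul_mem hq hg')) hg
  have hq1 : q⁻¹ = 1 := by
    by_contra hne
    obtain ⟨j, hj, hd⟩ := cs.exists_isRightDescent_of_mem_closure (inv_mem hq) hne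
    apply hz j hj
    have h1 := hadd _ (inv_mem hq)
    have h2 := hadd _ (mul_mem (inv_mem hq) (cs.simple_mem_closure hj))
    rw [← mul_assoc] at h2
    rw [IsRightDescent] at hd ⊢
    simp only [mul_inv_cancel_right] at h1 h2
    lia
  have hq1 : q = 1 := by simpa using hq1
  simpa [hq1] using hadd p hp

theorem length_mul_of_forall_not_isLeftDescent {J : Set B} {z p : W}
    (hz : ∀ j ∈ J, ¬cs.IsLeftDescent z j) (hp : p ∈ Subgroup.closure (cs.simple '' J)) :
    cs.length (p * z) = cs.length p + cs.length z := by
  have := cs.length_mul_of_forall_not_isRightDescent (z := z⁻¹) (p := p⁻¹)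
    (fun j hj ↦ by rw [cs.isRightDescent_inv_iff]; exact hz j hj) (inv_mem hp)
  rw [← mul_inv_rev, length_inv, length_inv, length_inv] at this
  lia

/-- If multiplying on the right by a simple reflection creates a left descent `e`, then the two
multiplications agree. -/
theorem mul_simple_eq_simple_mul {z : W} {c e : B} (he : ¬cs.IsLeftDescent z e)
    (hc : ¬cs.IsRightDescent z c) (h : cs.IsLeftDescent (z * cs.simple c) e) :
    z * cs.simple c = cs.simple e * z := by
  obtain ⟨ω, hω, rfl⟩ := cs.exists_isReduced z
  have hd : cs.IsRightDescent (cs.wordProd (c :: ω.reverse)) e := by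
    rw [← cs.isLeftDescent_inv_iff, wordProd_cons, wordProd_reverse]
    simpa using h
  obtain ⟨j, hj, hprod⟩ := cs.exists_wordProd_eraseIdx_of_isRightDescent hd
  rcases j with _ | j
  · rw [wordProd_cons, wordProd_reverse, List.eraseIdx_cons_zero, wordProd_reverse] at hprod
    have := congrArg (fun g ↦ (g * cs.simple e)⁻¹) hprod
    simpa using this
  · exfalso
    apply he
    rw [wordProd_cons, List.eraseIdx_cons_succ, wordProd_cons, mul_assoc, mul_right_inj,
      wordProd_reverse] at hprod
    have h1 := cs.length_wordProd_le (ω.reverse.eraseIdx j)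
    have hj' : j < ω.reverse.length := by simpa using hj
    rw [← hprod, List.length_eraseIdx_of_lt hj', ← length_inv] at h1
    simp at h1 hj
    rw [IsLeftDescent, hω.eq]
    lia

theorem IsRightDescent.mul_left {g z : W} {i : B} (h : cs.IsRightDescent z i)
    (hadd : cs.length (g * z) = cs.length g + cs.length z) : cs.IsRightDescent (g * z) i := by
  have := cs.length_mul_le g (z * cs.simple i)
  rw [IsRightDescent] at h ⊢
  rw [mul_assoc]
  lia

theorem IsRightDescent.length_mul {g z : W} {i : B} (h : cs.IsRightDescent z i)
    (hadd : cs.length (g * z) = cs.length g + cs.length z) :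
    cs.length (g * (z * cs.simple i)) = cs.length g + cs.length (z * cs.simple i) := by
  have h1 := cs.length_mul_le g (z * cs.simple i)
  have h2 := cs.isRightDescent_iff.mp (h.mul_left cs hadd)
  have h3 := cs.isRightDescent_iff.mp h
  rw [mul_assoc] at h2
  lia

end General

end CoxeterSystem

namespace CoxeterSystem

section Dihedral

variable {B W : Type*} [Group W] {M : CoxeterMatrix B} (cs : CoxeterSystem M W)

theorem IsRightDescent.of_mul_inv {J : Set B} {v q : W} {b : B} (h : cs.IsRightDescent v b)
    (hb : b ∈ J) (hq : q ∈ Subgroup.closure (cs.simple '' J))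
    (hv : ∀ j ∈ J, ¬cs.IsRightDescent (v * q⁻¹) j) : cs.IsRightDescent q b := by
  have h1 := cs.length_mul_of_forall_not_isRightDescent hv hq
  have h2 := cs.length_mul_of_forall_not_isRightDescent hv (mul_mem hq (cs.simple_mem_closure hb))
  rw [← mul_assoc] at h2
  rw [IsRightDescent] at h ⊢
  simp only [inv_mul_cancel_right] at h1 h2
  lia

theorem not_isRightDescent_mul_simple {v : W} {a : B} (h : cs.IsRightDescent v a) :
    ¬cs.IsRightDescent (v * cs.simple a) a :=
  cs.isRightDescent_iff_not_isRightDescent_mul.mp h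

theorem IsRightDescent.mul_simple {v : W} {a b : B} (hab : cs.simple a ≠ cs.simple b)
    (ha : cs.IsRightDescent v a) (hb : cs.IsRightDescent v b) :
    cs.IsRightDescent (v * cs.simple a) b := by
  by_contra hn
  have hd := IsRightDescent.of_mul_inv (J := {a, b}) (q := cs.simple a) cs hb (by simp)
    (cs.simple_mem_closure (by simp))
    (by simpa using ⟨cs.not_isRightDescent_mul_simple ha, hn⟩)
  have h : cs.length (cs.simple a * cs.simple b) = 0 := by
    rw [IsRightDescent, length_simple] at hd; lia
  rw [length_eq_zero_iff, mul_eq_one_iff_eq_inv, inv_simple] at h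
  exact hab h

theorem orderOf_dvd_of_isRightDescent_two {a b : B}
    (h : cs.IsRightDescent (cs.simple b * cs.simple a) b) :
    orderOf (cs.simple a * cs.simple b) ∣ 2 := by
  rw [show cs.simple b * cs.simple a = cs.wordProd [b, a] by simp [wordProd]] at h
  obtain ⟨j, hj, h⟩ := cs.exists_wordProd_eraseIdx_of_isRightDescent h
  apply orderOf_dvd_of_pow_eq_one
  simp only [List.length_cons, List.length_nil] at hj
  have hb := cs.simple_mul_simple_self
  interval_cases j
  · simp only [wordProd, List.eraseIdx_cons_zero, List.map_cons, List.map_nil, List.prod_cons,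
      List.prod_nil, mul_one, mul_assoc] at h
    rw [pow_two, mul_assoc, h, hb]
  · simp only [wordProd, List.eraseIdx_cons_succ, List.eraseIdx_cons_zero, List.map_cons,
      List.map_nil, List.prod_cons, List.prod_nil, mul_one, mul_assoc, mul_eq_left] at h
    rw [h, one_pow]

theorem IsRightDescent.mul_simple_mul_simple {v : W} {a b : B}
    (hord : orderOf (cs.simple a * cs.simple b) = 0 ∨ 4 ≤ orderOf (cs.simple a * cs.simple b))
    (ha : cs.IsRightDescent v a) (hb : cs.IsRightDescent v b) :
    cs.IsRightDescent (v * cs.simple a * cs.simple b) a := by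
  have hab : cs.simple a ≠ cs.simple b := by
    intro h; rw [h] at hord; simp at hord
  by_contra hn
  have hd := IsRightDescent.of_mul_inv (J := {a, b}) (q := cs.simple b * cs.simple a) cs hb
    (by simp) (mul_mem (cs.simple_mem_closure (by simp)) (cs.simple_mem_closure (by simp)))
    (by
      simpa [← mul_assoc] using
        ⟨hn, cs.not_isRightDescent_mul_simple (ha.mul_simple cs hab hb)⟩)
  have := Nat.le_of_dvd (by simp) (cs.orderOf_dvd_of_isRightDescent_two hd)
  have h0 := cs.orderOf_dvd_of_isRightDescent_two hd
  rcases hord with h | h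
  · rw [h] at h0; simp at h0
  · lia

theorem orderOf_le_of_isRightDescent_three {a b : B}
    (h : cs.IsRightDescent (cs.simple a * cs.simple b * cs.simple a) b) :
    0 < orderOf (cs.simple a * cs.simple b) ∧ orderOf (cs.simple a * cs.simple b) ≤ 3 := by
  rw [show cs.simple a * cs.simple b * cs.simple a = cs.wordProd [a, b, a] by
    simp [wordProd, mul_assoc]] at h
  obtain ⟨j, hj, h⟩ := cs.exists_wordProd_eraseIdx_of_isRightDescent h
  suffices ∃ k, 0 < k ∧ k ≤ 3 ∧ (cs.simple a * cs.simple b) ^ k = 1 by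
    obtain ⟨k, hk, hk3, h⟩ := this
    exact ⟨orderOf_pos_iff.mpr (isOfFinOrder_iff_pow_eq_one.mpr ⟨k, hk, h⟩),
      (Nat.le_of_dvd hk (orderOf_dvd_of_pow_eq_one h)).trans hk3⟩
  simp only [List.length_cons, List.length_nil] at hj
  interval_cases j
  · refine ⟨3, by simp, le_rfl, ?_⟩
    simp [wordProd, mul_assoc] at h
    simp [pow_succ, mul_assoc, h]
  · refine ⟨2, by simp, by simp, ?_⟩
    simp [wordProd, mul_assoc] at h
    simp [pow_succ, mul_assoc, h]
  · refine ⟨1, by simp, by simp, ?_⟩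
    simpa [wordProd, mul_assoc] using h

theorem IsRightDescent.mul_simple_mul_simple_mul_simple {v : W} {a b : B}
    (hord : orderOf (cs.simple a * cs.simple b) = 0 ∨ 4 ≤ orderOf (cs.simple a * cs.simple b))
    (ha : cs.IsRightDescent v a) (hb : cs.IsRightDescent v b) :
    cs.IsRightDescent (v * cs.simple a * cs.simple b * cs.simple a) b := by
  by_contra hn
  have hd := IsRightDescent.of_mul_inv (J := {a, b})
    (q := cs.simple a * cs.simple b * cs.simple a) cs hb (by simp)
    (mul_mem (mul_mem (cs.simple_mem_closure (by simp)) (cs.simple_mem_closure (by simp)))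
      (cs.simple_mem_closure (by simp)))
    (by
      simpa [← mul_assoc] using
        ⟨cs.not_isRightDescent_mul_simple (ha.mul_simple_mul_simple cs hord hb), hn⟩)
  have := cs.orderOf_le_of_isRightDescent_three hd
  lia

/-- In a dihedral parabolic subgroup the right descents along a reduced word alternate. -/
theorem IsRightDescent.alternate {w : W} {i j : B}
    (hw : w ∈ Subgroup.closure (cs.simple '' {i, j})) (h2 : 2 ≤ cs.length w)
    (hi : cs.IsRightDescent w i) : cs.IsRightDescent (w * cs.simple i) j := by
  have hlen := cs.isRightDescent_iff.mp hi
  obtain ⟨k, hk, hd⟩ := cs.exists_isRightDescent_of_mem_closure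
    (mul_mem hw (cs.simple_mem_closure (i := i) (by simp)))
    (by intro h; rw [h, length_one] at hlen; lia)
  rcases hk with rfl | rfl
  · exact absurd hd (cs.not_isRightDescent_mul_simple hi)
  · exact hd

end Dihedral

section Triangle

variable {B W : Type*} [Group W] {M : CoxeterMatrix B} (cs : CoxeterSystem M W)

/-- The generators are indexed by `s`, `a`, `b`; those of `a` and `b` commute and are distinct,
and both generate with that of `s` a dihedral group of order at least `8`. -/
structure IsTriangle (s a b : B) : Prop where
  comm : cs.simple a * cs.simple b = cs.simple b * cs.simple a
  ne : cs.simple a ≠ cs.simple b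
  order_left : orderOf (cs.simple s * cs.simple a) = 0 ∨ 4 ≤ orderOf (cs.simple s * cs.simple a)
  order_right : orderOf (cs.simple s * cs.simple b) = 0 ∨ 4 ≤ orderOf (cs.simple s * cs.simple b)
  cover : ∀ i : B, i = s ∨ i = a ∨ i = b

variable {cs} {s a b : B}

namespace IsTriangle

theorem swap (h : cs.IsTriangle s a b) : cs.IsTriangle s b a :=
  ⟨h.comm.symm, h.ne.symm, h.order_right, h.order_left, fun i ↦ by
    have := h.cover i; tauto⟩

theorem ne_left (h : cs.IsTriangle s a b) : cs.simple s ≠ cs.simple a := by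
  intro e; have := h.order_left; rw [e] at this; simp at this

theorem order_left' (h : cs.IsTriangle s a b) :
    orderOf (cs.simple a * cs.simple s) = 0 ∨ 4 ≤ orderOf (cs.simple a * cs.simple s) := by
  rw [← orderOf_inv]; simpa using h.order_left

theorem not_isRightDescent_mul_simple (h : cs.IsTriangle s a b) {v : W}
    (hs : cs.IsRightDescent v s) (hb : cs.IsRightDescent v b) :
    ¬cs.IsRightDescent (v * cs.simple s) a := by
  induction hn : cs.length v using Nat.strong_induction_on generalizing v with
  | _ n ih =>
    intro ha
    have hsb := hs.mul_simple cs h.swap.ne_left hb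
    have hsbs := hs.mul_simple_mul_simple cs h.order_right hb
    have hsbsb := hs.mul_simple_mul_simple_mul_simple cs h.order_right hb
    have hsba := hsb.mul_simple cs h.ne.symm ha
    have h1 := hsbs.mul_simple cs h.ne_left hsba
    have h2 := hsbs.mul_simple_mul_simple cs h.order_left hsba
    have h3 := hsbs.mul_simple_mul_simple_mul_simple cs h.order_left hsba
    have h4 := h1.mul_simple cs h.ne hsbsb
    refine ih _ ?_ h2 h4 rfl h3
    rw [IsRightDescent] at hs hsb hsbs h1
    lia

theorem not_isRightDescent_of_full (h : cs.IsTriangle s a b) {v : W}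
    (hb : cs.IsRightDescent (v * cs.simple b) b) (hbs : cs.IsRightDescent (v * cs.simple b) s)
    (ha : cs.IsRightDescent (v * cs.simple a) a) : ¬cs.IsRightDescent (v * cs.simple a) s := by
  induction hn : cs.length v using Nat.strong_induction_on generalizing v with
  | _ n ih =>
    intro has
    have h1 := hb.mul_simple cs h.swap.ne_left.symm hbs
    have h2 := hb.mul_simple_mul_simple cs h.swap.order_left' hbs
    have h3 := hb.mul_simple_mul_simple_mul_simple cs h.swap.order_left' hbs
    have h4 := ha.mul_simple_mul_simple cs h.order_left' has
    have h5 := ha.mul_simple_mul_simple_mul_simple cs h.order_left' has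
    simp only [simple_mul_simple_cancel_right] at h1 h2 h3 h4 h5
    have h6 := h4.mul_simple cs h.ne h2
    have h7 := h2.mul_simple cs h.ne.symm h4
    have e : v * cs.simple s * cs.simple a * cs.simple b * cs.simple a =
        v * cs.simple s * cs.simple b := by
      rw [mul_assoc (v * cs.simple s), h.comm]; simp [mul_assoc]
    refine ih (cs.length (v * cs.simple s * cs.simple a * cs.simple b)) ?_
      (v := v * cs.simple s * cs.simple a * cs.simple b) ?_ ?_ ?_ rfl ?_
    · rw [IsRightDescent] at h1 h4 h6
      lia
    · simpa using h6
    · simpa using h5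
    · rwa [e]
    · rwa [e]

end IsTriangle

end Triangle

end CoxeterSystem

namespace CoxeterSystem

section Parabolic

variable {B W : Type*} [Group W] {M : CoxeterMatrix B} (cs : CoxeterSystem M W)

theorem IsLeftDescent.mul_right {z p : W} {i : B} (h : cs.IsLeftDescent z i)
    (hadd : cs.length (z * p) = cs.length z + cs.length p) : cs.IsLeftDescent (z * p) i := by
  have := cs.length_mul_le (cs.simple i * z) p
  rw [IsLeftDescent] at h ⊢
  rw [← mul_assoc]
  lia

theorem IsRightDescent.mul_left_of_mem_closure {J : Set B} {x u : W} {i : B}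
    (h : cs.IsRightDescent u i) (hx : ∀ j ∈ J, ¬cs.IsRightDescent x j)
    (hu : u ∈ Subgroup.closure (cs.simple '' J)) : cs.IsRightDescent (x * u) i :=
  h.mul_left cs (cs.length_mul_of_forall_not_isRightDescent hx hu)

theorem isRightDescent_of_mul_simple_eq {z : W} {c e d : B}
    (h : z * cs.simple c = cs.simple e * z) (hc : ¬cs.IsRightDescent z c)
    (hd : cs.IsRightDescent z d) : cs.IsRightDescent (z * cs.simple c) d := by
  have h1 := cs.length_mul_le (cs.simple e) (z * cs.simple d)
  rw [← mul_assoc, ← h, cs.length_simple] at h1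
  have h2 := cs.not_isRightDescent_iff.mp hc
  rw [IsRightDescent] at hd ⊢
  lia

theorem isRightDescent_mul_simple_self {z : W} {c : B} (hc : ¬cs.IsRightDescent z c) :
    cs.IsRightDescent (z * cs.simple c) c := by
  by_contra hn
  exact hc (cs.isRightDescent_iff_not_isRightDescent_mul.mpr hn)

end Parabolic

namespace IsTriangle

variable {B W : Type*} [Group W] {M : CoxeterMatrix B} {cs : CoxeterSystem M W} {s a b : B}

theorem simple_injective (h : cs.IsTriangle s a b) : Function.Injective cs.simple := by
  intro i j hij
  have h1 := h.ne_left
  have h2 := h.swap.ne_left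
  have h3 := h.ne
  rcases h.cover i with rfl | rfl | rfl <;> rcases h.cover j with rfl | rfl | rfl <;>
    first | rfl | exact absurd hij (by assumption) | exact absurd hij.symm (by assumption)

theorem not_isRightDescent_of_conj_center (h : cs.IsTriangle s a b) {g z : W} {e : B}
    (hze : z * cs.simple s = cs.simple e * z) (hs : ¬cs.IsRightDescent z s)
    (hb : cs.IsRightDescent z b) (hadd : cs.length (g * z) = cs.length g + cs.length z) :
    ¬cs.IsRightDescent (g * z) a := by
  intro ha
  have hss := cs.isRightDescent_mul_simple_self hs
  have hsb := cs.isRightDescent_of_mul_simple_eq hze hs hb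
  have h1 := hss.mul_simple_mul_simple cs h.order_right hsb
  have h2 := hss.mul_simple_mul_simple_mul_simple cs h.order_right hsb
  simp only [simple_mul_simple_cancel_right] at h1 h2
  have hadd1 := hb.length_mul cs hadd
  have hadd2 := h1.length_mul cs hadd1
  have k1 := h1.mul_left cs hadd1
  have k2 := h2.mul_left cs hadd2
  have k3 := (hb.mul_left cs hadd).mul_simple cs h.ne.symm ha
  simp only [← mul_assoc] at k1 k2
  exact h.swap.not_isRightDescent_mul_simple k1 k3 k2

theorem not_isRightDescent_of_conj_side (h : cs.IsTriangle s a b) {g z : W} {e : B}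
    (hze : z * cs.simple a = cs.simple e * z) (ha : ¬cs.IsRightDescent z a)
    (hb : cs.IsRightDescent z b) (hzb : z * cs.simple b ≠ 1)
    (hadd : cs.length (g * z) = cs.length g + cs.length z)
    (hadd' : cs.length (g * cs.simple e * z) = cs.length g + 1 + cs.length z) :
    ¬cs.IsRightDescent (g * z) s := by
  intro hs
  set z₁ := z * cs.simple b with hz₁
  have hz : z = z₁ * cs.simple b := by simp [hz₁]
  have hze₁ : z₁ * cs.simple a = cs.simple e * z₁ := by
    rw [hz₁, mul_assoc, ← h.comm, ← mul_assoc, hze, mul_assoc]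
  have hlen := cs.isRightDescent_iff.mp hb
  rw [← hz₁] at hlen
  have ha₁ : ¬cs.IsRightDescent z₁ a := by
    intro hd
    have h1 := cs.not_isRightDescent_iff.mp ha
    have h2 := cs.length_mul_le (z₁ * cs.simple a) (cs.simple b)
    rw [mul_assoc, h.comm, ← mul_assoc, ← hz, cs.length_simple] at h2
    rw [IsRightDescent] at hd
    lia
  have hs₁ : cs.IsRightDescent z₁ s := by
    obtain ⟨d, hd⟩ := cs.exists_rightDescent_of_ne_one hzb
    rcases h.cover d with rfl | rfl | rfl
    · exact hd
    · exact absurd hd ha₁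
    · exact absurd hd (cs.not_isRightDescent_mul_simple hb)
  have hlen' := cs.not_isRightDescent_iff.mp ha₁
  have hadd₁ : cs.length (g * (z₁ * cs.simple a)) =
      cs.length g + cs.length (z₁ * cs.simple a) := by
    have h1 := cs.length_mul_le (g * cs.simple e * z₁) (cs.simple b)
    have h2 := cs.length_mul_le g (z₁ * cs.simple a)
    rw [mul_assoc (g * cs.simple e), ← hz, cs.length_simple] at h1
    rw [hze₁, ← mul_assoc, ← hze₁] at h2 ⊢
    lia
  have k1 := (cs.isRightDescent_mul_simple_self ha₁).mul_left cs hadd₁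
  have k2 := (cs.isRightDescent_of_mul_simple_eq hze₁ ha₁ hs₁).mul_left cs hadd₁
  have k3 := hb.mul_left cs hadd
  rw [hz, ← mul_assoc] at hs k3
  rw [← mul_assoc] at k1 k2
  exact h.not_isRightDescent_of_full k3 hs k1 k2

theorem not_isRightDescent_mul (h : cs.IsTriangle s a b) {x w : W}
    (hx : ∀ j ∈ ({s, a} : Set B), ¬cs.IsRightDescent x j)
    (hw : w ∈ Subgroup.closure (cs.simple '' {s, a})) (h4 : 4 ≤ cs.length w) :
    ¬cs.IsRightDescent (x * w) b := by
  intro hb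
  have hsmem : cs.simple s ∈ Subgroup.closure (cs.simple '' {s, a}) :=
    cs.simple_mem_closure (by simp)
  have hamem : cs.simple a ∈ Subgroup.closure (cs.simple '' {s, a}) :=
    cs.simple_mem_closure (by simp)
  have hw' := hw
  rw [Set.pair_comm] at hw'
  obtain ⟨j, hj, hd⟩ := cs.exists_isRightDescent_of_mem_closure hw
    (by rintro rfl; simp at h4)
  have hlen := cs.isRightDescent_iff.mp hd
  rcases hj with rfl | rfl
  · have h1 := hd.alternate cs hw (by lia)
    have k0 := hd.mul_left_of_mem_closure cs hx hw
    have k1 := h1.mul_left_of_mem_closure cs hx (mul_mem hw hsmem)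
    rw [← mul_assoc] at k1
    exact h.not_isRightDescent_mul_simple k0 hb k1
  · have h1 := hd.alternate cs hw' (by lia)
    have hlen1 := cs.isRightDescent_iff.mp h1
    have h2 := h1.alternate cs (mul_mem hw hamem) (by lia)
    have k0 := hd.mul_left_of_mem_closure cs hx hw
    have k1 := h1.mul_left_of_mem_closure cs hx (mul_mem hw hamem)
    have k2 := h2.mul_left_of_mem_closure cs hx (mul_mem (mul_mem hw hamem) hsmem)
    simp only [← mul_assoc] at k1 k2
    exact h.not_isRightDescent_mul_simple k1 (k0.mul_simple cs h.ne hb) k2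

theorem not_isRightDescent_mul_simple_center (h : cs.IsTriangle s a b) {x w : W}
    (hx : ∀ j ∈ ({s, a} : Set B), ¬cs.IsRightDescent x j)
    (hw : w ∈ Subgroup.closure (cs.simple '' {s, a})) (h4 : 4 ≤ cs.length w)
    (hs : cs.IsRightDescent w s) : ¬cs.IsRightDescent (x * (w * cs.simple s)) b := by
  intro hb
  have hsmem : cs.simple s ∈ Subgroup.closure (cs.simple '' {s, a}) :=
    cs.simple_mem_closure (by simp)
  have hamem : cs.simple a ∈ Subgroup.closure (cs.simple '' {s, a}) :=
    cs.simple_mem_closure (by simp)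
  have l0 := cs.isRightDescent_iff.mp hs
  have h1 := hs.alternate cs hw (by lia)
  have l1 := cs.isRightDescent_iff.mp h1
  have h2 := h1.alternate cs (j := s) (by rw [Set.pair_comm]; exact mul_mem hw hsmem) (by lia)
  have l2 := cs.isRightDescent_iff.mp h2
  have h3 := h2.alternate cs (mul_mem (mul_mem hw hsmem) hamem) (by lia)
  have k1 := h1.mul_left_of_mem_closure cs hx (mul_mem hw hsmem)
  have k2 := h2.mul_left_of_mem_closure cs hx (mul_mem (mul_mem hw hsmem) hamem)
  have k3 := h3.mul_left_of_mem_closure cs hx (mul_mem (mul_mem (mul_mem hw hsmem) hamem) hsmem)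
  simp only [← mul_assoc] at k1 k2 k3 hb
  exact h.not_isRightDescent_mul_simple k2 (k1.mul_simple cs h.ne hb) k3

theorem not_isRightDescent_mul_simple_side (h : cs.IsTriangle s a b) {x w : W}
    (hx : ∀ j ∈ ({s, a} : Set B), ¬cs.IsRightDescent x j)
    (hw : w ∈ Subgroup.closure (cs.simple '' {s, a})) (h4 : 4 ≤ cs.length w)
    (ha : cs.IsRightDescent w a) (hb : ¬cs.IsRightDescent (x * (w * cs.simple a)) b) :
    ¬cs.IsRightDescent (x * (w * cs.simple a) * cs.simple b) s := by
  intro hbs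
  have hsmem : cs.simple s ∈ Subgroup.closure (cs.simple '' {s, a}) :=
    cs.simple_mem_closure (by simp)
  have hamem : cs.simple a ∈ Subgroup.closure (cs.simple '' {s, a}) :=
    cs.simple_mem_closure (by simp)
  have hw' := hw
  rw [Set.pair_comm] at hw'
  have l0 := cs.isRightDescent_iff.mp ha
  have h1 := ha.alternate cs hw' (by lia)
  have l1 := cs.isRightDescent_iff.mp h1
  have h2 := h1.alternate cs (mul_mem hw hamem) (by lia)
  have l2 := cs.isRightDescent_iff.mp h2
  have h3 := h2.alternate cs (j := s)
    (by rw [Set.pair_comm]; exact mul_mem (mul_mem hw hamem) hsmem) (by lia)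
  have k2 := h2.mul_left_of_mem_closure cs hx (mul_mem (mul_mem hw hamem) hsmem)
  have k3 := h3.mul_left_of_mem_closure cs hx (mul_mem (mul_mem (mul_mem hw hamem) hsmem) hamem)
  have hbb := cs.isRightDescent_mul_simple_self hb
  have m2 := hbb.mul_simple_mul_simple cs h.swap.order_left' hbs
  have m3 := hbb.mul_simple_mul_simple_mul_simple cs h.swap.order_left' hbs
  simp only [simple_mul_simple_cancel_right] at m2 m3
  simp only [← mul_assoc] at k2 k3 m2 m3
  set v := x * w * cs.simple a * cs.simple s with hv
  have e : v * cs.simple a * cs.simple b * cs.simple a = v * cs.simple b := by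
    rw [mul_assoc v, h.comm]; simp [mul_assoc]
  refine h.not_isRightDescent_of_full (v := v * cs.simple a * cs.simple b) ?_ ?_ ?_ ?_
  · simpa using k2.mul_simple cs h.ne m2
  · simpa using k3
  · rw [e]; exact m2.mul_simple cs h.ne.symm k2
  · rw [e]; exact m3

theorem not_isRightDescent_of_conj (h : cs.IsTriangle s a b) {x w z : W} {c c' e : B}
    (hx : ∀ j ∈ ({s, a} : Set B), ¬cs.IsRightDescent x j)
    (hw : w ∈ Subgroup.closure (cs.simple '' {s, a})) (h4 : 4 ≤ cs.length w)
    (he : e ∈ ({s, a} : Set B)) (hwe : cs.IsRightDescent w e)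
    (hze : z * cs.simple c = cs.simple e * z)
    (hadd : cs.length (x * w * z) = cs.length x + cs.length w + cs.length z)
    (hc : ¬cs.IsRightDescent z c) (hc' : ¬cs.IsRightDescent z c')
    (hzc' : ∀ j ∈ ({s, a} : Set B), ¬cs.IsLeftDescent (z * cs.simple c') j)
    (hcc' : c ≠ c') (hJ : c = s ∨ c' = s) :
    ¬cs.IsRightDescent (x * (w * cs.simple e) * z) c' := by
  have hu := mul_mem hw (cs.simple_mem_closure he)
  have hlu := cs.length_mul_of_forall_not_isRightDescent hx hu
  have hlen := cs.isRightDescent_iff.mp hwe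
  have hge : x * (w * cs.simple e) * cs.simple e = x * w := by simp [mul_assoc]
  have hadd' : cs.length (x * (w * cs.simple e) * cs.simple e * z) =
      cs.length (x * (w * cs.simple e)) + 1 + cs.length z := by
    rw [hge]; lia
  have hadd₀ : cs.length (x * (w * cs.simple e) * z) =
      cs.length (x * (w * cs.simple e)) + cs.length z := by
    have h1 := cs.length_mul_le (x * (w * cs.simple e) * z) (cs.simple c)
    rw [mul_assoc _ z, hze, ← mul_assoc, cs.length_simple] at h1
    have h2 := cs.length_mul_le (x * (w * cs.simple e)) z
    lia
  have hsa : s ≠ a := fun e ↦ h.ne_left (congrArg _ e)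
  have hsb : s ≠ b := fun e ↦ h.swap.ne_left (congrArg _ e)
  have hab : a ≠ b := fun e ↦ h.ne (congrArg _ e)
  by_cases hz1 : z = 1
  · subst hz1
    rw [one_mul, mul_one] at hze
    have hce := h.simple_injective hze
    subst hce
    have hc'I : c' ∉ ({s, a} : Set B) := fun hm ↦ hzc' c' hm (by simp [IsLeftDescent])
    have hc'b : c' = b := by
      rcases h.cover c' with rfl | rfl | rfl
      · simp at hc'I
      · simp at hc'I
      · rfl
    subst hc'b
    obtain rfl : c = s := hJ.resolve_right hsb.symm
    rw [mul_one]
    exact h.not_isRightDescent_mul_simple_center hx hw h4 hwe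
  · obtain ⟨d, hd⟩ := cs.exists_rightDescent_of_ne_one hz1
    have hdc : d ≠ c := by rintro rfl; exact hc hd
    have hdc' : d ≠ c' := by rintro rfl; exact hc' hd
    rcases hJ with rfl | rfl
    · have hT : cs.IsTriangle c c' d := by
        rcases h.cover c' with rfl | rfl | rfl <;> rcases h.cover d with rfl | rfl | rfl <;>
          first | exact h | exact h.swap | contradiction
      exact hT.not_isRightDescent_of_conj_center hze hc hd hadd₀
    · have hT : cs.IsTriangle c' c d := by
        rcases h.cover c with rfl | rfl | rfl <;> rcases h.cover d with rfl | rfl | rfl <;>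
          first | exact h | exact h.swap | contradiction
      by_cases hzd : z * cs.simple d = 1
      · have hz : z = cs.simple d := by
          rw [mul_eq_one_iff_eq_inv, inv_simple] at hzd; exact hzd
        subst hz
        rw [← hT.comm, mul_left_inj] at hze
        have hce := h.simple_injective hze
        subst hce
        obtain rfl : c = a := he.resolve_left hcc'
        obtain rfl : d = b := by
          rcases h.cover d with rfl | rfl | rfl <;> first | rfl | contradiction
        refine h.not_isRightDescent_mul_simple_side hx hw h4 hwe ?_
        rw [cs.not_isRightDescent_iff, hadd₀, length_simple]
      · exact hT.not_isRightDescent_of_conj_side hze hc hd hzd hadd₀ hadd'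

theorem length_mul_mul (h : cs.IsTriangle s a b) {x w y : W}
    (hx : ∀ j ∈ ({s, a} : Set B), ¬cs.IsRightDescent x j)
    (hw : w ∈ Subgroup.closure (cs.simple '' {s, a})) (h4 : 4 ≤ cs.length w)
    (hy : ∀ j ∈ ({s, a} : Set B), ¬cs.IsLeftDescent y j) :
    cs.length (x * w * y) = cs.length x + cs.length w + cs.length y := by
  induction hn : cs.length y using Nat.strong_induction_on generalizing y w with
  | _ n ih =>
  subst hn
  have hxw := cs.length_mul_of_forall_not_isRightDescent hx hw
  by_cases hy1 : y = 1
  · simp [hy1, hxw]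
  obtain ⟨a₁, ha₁⟩ := cs.exists_rightDescent_of_ne_one hy1
  by_cases hy2 : y * cs.simple a₁ = 1
  · obtain rfl : y = cs.simple a₁ := by
      rw [mul_eq_one_iff_eq_inv, inv_simple] at hy2; exact hy2
    have ha₁I : a₁ ∉ ({s, a} : Set B) := fun hm ↦ hy a₁ hm (by simp [IsLeftDescent])
    obtain rfl : a₁ = b := by
      rcases h.cover a₁ with rfl | rfl | rfl
      · simp at ha₁I
      · simp at ha₁I
      · rfl
    rw [cs.not_isRightDescent_iff.mp (h.not_isRightDescent_mul hx hw h4), hxw, length_simple]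
  obtain ⟨b₁, hb₁⟩ := cs.exists_rightDescent_of_ne_one hy2
  obtain ⟨z, p, hp, hzJ, rfl, hyl⟩ := cs.exists_mul_mem_closure {a₁, b₁} y
  have hpa : cs.IsRightDescent p a₁ :=
    ha₁.of_mul_inv cs (J := {a₁, b₁}) (by simp) hp (by simpa using hzJ)
  have hpb : cs.IsRightDescent (p * cs.simple a₁) b₁ :=
    hb₁.of_mul_inv cs (J := {a₁, b₁}) (by simp)
      (mul_mem hp (cs.simple_mem_closure (by simp))) (by simpa [mul_assoc] using hzJ)
  have hp2 : 2 ≤ cs.length p := by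
    rw [IsRightDescent] at hpa hpb; lia
  have hab₁ : a₁ ≠ b₁ := by
    rintro rfl; exact cs.not_isRightDescent_mul_simple hpa hpb
  obtain ⟨c', hc'J, hc'p⟩ := cs.exists_isRightDescent_of_mem_closure (inv_mem hp)
    (by rw [Ne, inv_eq_one]; rintro rfl; simp at hp2)
  rw [isRightDescent_inv_iff] at hc'p
  obtain ⟨c, hcc', hJ⟩ : ∃ c, c ≠ c' ∧ ({a₁, b₁} : Set B) = {c', c} := by
    rcases hc'J with rfl | rfl
    · exact ⟨b₁, hab₁.symm, rfl⟩
    · exact ⟨a₁, hab₁, Set.pair_comm _ _⟩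
  rw [hJ] at hp hzJ
  clear hb₁ hy2 ha₁ hpa hpb hab₁ hc'J hJ
  have hzc := hzJ c (by simp)
  have hzc' := hzJ c' (by simp)
  have lzc := cs.not_isRightDescent_iff.mp hzc
  have lzc' := cs.not_isRightDescent_iff.mp hzc'
  have lc'p := cs.isLeftDescent_iff.mp hc'p
  have hzI : ∀ j ∈ ({s, a} : Set B), ¬cs.IsLeftDescent z j :=
    fun j hj hd ↦ hy j hj (hd.mul_right cs hyl)
  have hzc'I : ∀ j ∈ ({s, a} : Set B), ¬cs.IsLeftDescent (z * cs.simple c') j := by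
    intro j hj hd
    apply hy j hj
    have e : z * cs.simple c' * (cs.simple c' * p) = z * p := by simp [mul_assoc]
    rw [← e]
    exact hd.mul_right cs (by rw [e]; lia)
  have hxwz := ih (cs.length z) (by lia) hw h4 hzI rfl
  have hdesc : ∀ i, cs.length (z * cs.simple i) = cs.length z + 1 →
      (∀ j ∈ ({s, a} : Set B), ¬cs.IsLeftDescent (z * cs.simple i) j) →
      ¬cs.IsRightDescent (x * w * z) i := by
    intro i hi hI
    have := ih (cs.length (z * cs.simple i)) (by lia) hw h4 hI rfl
    rw [cs.not_isRightDescent_iff, mul_assoc _ z, this]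
    lia
  have hfin : ¬cs.IsRightDescent (x * w * z) c →
      cs.length (x * w * (z * p)) = cs.length x + cs.length w + cs.length (z * p) := by
    intro hc
    rw [← mul_assoc, cs.length_mul_of_forall_not_isRightDescent _ hp]
    · lia
    · rintro j (rfl | rfl)
      exacts [hdesc _ lzc' hzc'I, hc]
  by_cases hcI : ∀ j ∈ ({s, a} : Set B), ¬cs.IsLeftDescent (z * cs.simple c) j
  · exact hfin (hdesc _ lzc hcI)
  push Not at hcI
  obtain ⟨e, he, hed⟩ := hcI
  have hze := cs.mul_simple_eq_simple_mul (hzI e he) hzc hed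
  by_cases hwe : cs.IsRightDescent w e
  · have hcp : ¬cs.IsLeftDescent p c := by
      intro hd
      apply hy e he
      have h1 := cs.length_mul_le z (cs.simple c * p)
      rw [← mul_assoc, hze, mul_assoc] at h1
      rw [IsLeftDescent] at hd ⊢
      lia
    have hcs : c = s ∨ c' = s := by
      by_contra! hne
      have hcomm : cs.simple c * cs.simple c' = cs.simple c' * cs.simple c := by
        rcases h.cover c with rfl | rfl | rfl <;> rcases h.cover c' with rfl | rfl | rfl <;>
          first | exact h.comm | exact h.swap.comm | simp_all
      rw [← cs.isRightDescent_inv_iff] at hcp hc'p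
      have h1 := hc'p.alternate cs (inv_mem hp) (by rwa [length_inv])
      apply hcp
      have h2 := cs.length_mul_le (p⁻¹ * cs.simple c' * cs.simple c) (cs.simple c')
      rw [mul_assoc _ (cs.simple c), hcomm, ← mul_assoc, simple_mul_simple_cancel_right,
        length_simple] at h2
      rw [IsRightDescent] at h1 hc'p ⊢
      lia
    have hkey := h.not_isRightDescent_of_conj hx hw h4 he hwe hze hxwz hzc hzc' hzc'I hcc' hcs
    have lwe := cs.isRightDescent_iff.mp hwe
    have e₁ : x * (w * cs.simple e) * z * cs.simple c = x * w * z := by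
      rw [mul_assoc _ z, hze]; simp [mul_assoc]
    have l1 := cs.length_mul_of_forall_not_isRightDescent hx
      (mul_mem hw (cs.simple_mem_closure he))
    have l2 := cs.length_mul_le (x * (w * cs.simple e)) z
    have l3 := cs.length_mul_le (x * (w * cs.simple e) * z) (cs.simple c)
    rw [e₁, length_simple] at l3
    have hkey' : ¬cs.IsRightDescent (x * (w * cs.simple e) * z) c := by
      rw [IsRightDescent, e₁]; lia
    have hmul := cs.length_mul_of_forall_not_isRightDescent (J := {c', c})
      (z := x * (w * cs.simple e) * z) (p := cs.simple c * p)
      (by rintro j (rfl | rfl); exacts [hkey, hkey'])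
      (mul_mem (cs.simple_mem_closure (by simp)) hp)
    rw [← mul_assoc, e₁, cs.not_isLeftDescent_iff.mp hcp] at hmul
    rw [← mul_assoc]
    lia
  · apply hfin
    have lwe := cs.not_isRightDescent_iff.mp hwe
    have := ih (cs.length z) (by lia) (mul_mem hw (cs.simple_mem_closure he)) (by lia) hzI rfl
    rw [cs.not_isRightDescent_iff, mul_assoc _ z, hze, ← mul_assoc, mul_assoc x w, this]
    lia

theorem isRightDescent_mul_mul_iff (h : cs.IsTriangle s a b) {x w y : W}
    (hx : ∀ j ∈ ({s, a} : Set B), ¬cs.IsRightDescent x j)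
    (hw : w ∈ Subgroup.closure (cs.simple '' {s, a})) (h4 : 4 ≤ cs.length w)
    (hy : ∀ j ∈ ({s, a} : Set B), ¬cs.IsLeftDescent y j) (i : B) :
    cs.IsRightDescent (x * w * y) i ↔ cs.IsRightDescent (w * y) i := by
  have hadd := h.length_mul_mul hx hw h4 hy
  have hwy := cs.length_mul_of_forall_not_isLeftDescent hy hw
  constructor
  · contrapose
    intro hn
    have hyi : ¬cs.IsRightDescent y i := fun hd ↦ hn (hd.mul_left cs hwy)
    have lyi := cs.not_isRightDescent_iff.mp hyi
    rw [cs.not_isRightDescent_iff]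
    by_cases hI : ∀ j ∈ ({s, a} : Set B), ¬cs.IsLeftDescent (y * cs.simple i) j
    · rw [mul_assoc _ y, h.length_mul_mul hx hw h4 hI]
      lia
    · push Not at hI
      obtain ⟨e, he, hed⟩ := hI
      have hye := cs.mul_simple_eq_simple_mul (hy e he) hyi hed
      have hwe : ¬cs.IsRightDescent w e := by
        intro hd
        apply hn
        have := cs.length_mul_le (w * cs.simple e) y
        rw [IsRightDescent] at hd ⊢
        rw [mul_assoc w y, hye, ← mul_assoc]
        lia
      have lwe := cs.not_isRightDescent_iff.mp hwe
      rw [mul_assoc _ y, hye, ← mul_assoc, mul_assoc x w,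
        h.length_mul_mul hx (mul_mem hw (cs.simple_mem_closure he)) (by lia) hy]
      lia
  · intro hd
    rw [mul_assoc]
    exact hd.mul_left cs (by rw [← mul_assoc]; lia)

theorem isLeftDescent_mul_mul_iff (h : cs.IsTriangle s a b) {x w y : W}
    (hx : ∀ j ∈ ({s, a} : Set B), ¬cs.IsRightDescent x j)
    (hw : w ∈ Subgroup.closure (cs.simple '' {s, a})) (h4 : 4 ≤ cs.length w)
    (hy : ∀ j ∈ ({s, a} : Set B), ¬cs.IsLeftDescent y j) (i : B) :
    cs.IsLeftDescent (x * w * y) i ↔ cs.IsLeftDescent (x * w) i := by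
  have := h.isRightDescent_mul_mul_iff (x := y⁻¹) (w := w⁻¹) (y := x⁻¹)
    (by simpa [isRightDescent_inv_iff] using hy) (inv_mem hw) (by rwa [length_inv])
    (by simpa [isLeftDescent_inv_iff] using hx) i
  rwa [← mul_inv_rev, ← mul_inv_rev, ← mul_inv_rev, isRightDescent_inv_iff,
    isRightDescent_inv_iff, ← mul_assoc] at this

end IsTriangle

end CoxeterSystem

/-- Lemma 4.5: let `{α,β} = {t,r}`.  If `w` lies in the parabolic subgroup generated
by `{s,α}`, `ℓ(w) ≥ 4`, and `s, α ∉ R(x) ∪ L(y)`, then `ℓ(xwy) = ℓ(x)+ℓ(w)+ℓ(y)`,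
`R(xwy) = R(wy)` and `L(xwy) = L(xw)`. -/
theorem length_additive_and_descents_rank3
{W : Type*} [Group W] {M : CoxeterMatrix (Fin 3)} (cs : CoxeterSystem M W)
    (r s t : W) (hr : r = cs.simple 0) (hs : s = cs.simple 1) (ht : t = cs.simple 2)
    (hrt : orderOf (r * t) = 2)
    (hsr : orderOf (s * r) = 0 ∨ 4 ≤ orderOf (s * r))
    (hst : orderOf (s * t) = 0 ∨ 4 ≤ orderOf (s * t))
    (α β : W) (hab : (α = t ∧ β = r) ∨ (α = r ∧ β = t))
    (x y w : W) (hw : w ∈ Subgroup.closure ({s, α} : Set W))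
    (hlw : 4 ≤ cs.length w)
    (hxs : ¬ cs.length (x * s) < cs.length x) (hxa : ¬ cs.length (x * α) < cs.length x)
    (hys : ¬ cs.length (s * y) < cs.length y) (hya : ¬ cs.length (α * y) < cs.length y) :
    cs.length (x * w * y) = cs.length x + cs.length w + cs.length y ∧
    {a ∈ ({r, s, t} : Set W) | cs.length (x * w * y * a) < cs.length (x * w * y)} =
      {a ∈ ({r, s, t} : Set W) | cs.length (w * y * a) < cs.length (w * y)} ∧
    {a ∈ ({r, s, t} : Set W) | cs.length (a * (x * w * y)) < cs.length (x * w * y)} =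
      {a ∈ ({r, s, t} : Set W) | cs.length (a * (x * w)) < cs.length (x * w)} := by
  obtain ⟨a, b, hT, rfl, rfl⟩ : ∃ a b, cs.IsTriangle 1 a b ∧ cs.simple a = α ∧ cs.simple b = β := by
    subst hr hs ht
    have hcomm : cs.simple 0 * cs.simple 2 = cs.simple 2 * cs.simple 0 := by
      have h2 := pow_orderOf_eq_one (cs.simple 0 * cs.simple 2)
      rw [hrt, pow_two, mul_eq_one_iff_eq_inv] at h2
      simpa using h2
    have hne : cs.simple 0 ≠ cs.simple 2 := by
      intro e; rw [e] at hrt; simp at hrt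
    have hT : cs.IsTriangle 1 0 2 := ⟨hcomm, hne, hsr, hst, by decide⟩
    rcases hab with ⟨rfl, rfl⟩ | ⟨rfl, rfl⟩
    exacts [⟨2, 0, hT.swap, rfl, rfl⟩, ⟨0, 2, hT, rfl, rfl⟩]
  subst hs
  rw [← Set.image_pair] at hw
  have hx : ∀ j ∈ ({1, a} : Set (Fin 3)), ¬cs.IsRightDescent x j := by
    rintro j (rfl | rfl)
    exacts [hxs, hxa]
  have hy : ∀ j ∈ ({1, a} : Set (Fin 3)), ¬cs.IsLeftDescent y j := by
    rintro j (rfl | rfl)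
    exacts [hys, hya]
  have hsimple : ∀ g ∈ ({r, cs.simple 1, t} : Set W), ∃ i, g = cs.simple i := by
    rintro g (rfl | rfl | rfl)
    exacts [⟨0, hr⟩, ⟨1, rfl⟩, ⟨2, ht⟩]
  refine ⟨hT.length_mul_mul hx hw hlw hy, ?_, ?_⟩
  · ext g
    refine and_congr_right fun hg ↦ ?_
    obtain ⟨i, rfl⟩ := hsimple g hg
    exact hT.isRightDescent_mul_mul_iff hx hw hlw hy i
  · ext g
    refine and_congr_right fun hg ↦ ?_
    obtain ⟨i, rfl⟩ := hsimple g hg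
    exact hT.isLeftDescent_mul_mul_iff hx hw hlw hy i
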